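/- Let q be a prime power with q ≡ 3 (mod 4), n = 4q-4, ξ ∈ F_{q^2} a primitive n-th root of unity, and let C ⊆ F_q^n be the cyclic code C = {c ∈ F_q^n : c(1) = c(-1) = c(ξ) = c(ξ^q) = c(ξ^2) = c(ξ^{2q}) = 0, evaluation in F_{q^2}}. Then for all integers ℓ₁, ℓ₂ with 3 ≤ ℓ₁ < ℓ₂ ≤ n-2 and ℓ₂ - ℓ₁ ≥ 2, there is no codeword c ∈ C whose support is exactly {0, 1, ℓ₁, ℓ₂}; equivalently, C contains no codeword of the form (⋆,⋆,0_r,⋆,0_s,⋆,0_{n-r-s-4}) with each ⋆ a nonzero element of F_q, 1 ≤ r, s ≤ n-5 and 2 ≤ r+s ≤ n-5. -/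

import Mathlib

theorem IsPrimitiveRoot.pow_half_eq_neg_one {K : Type*} [Field K] {ξ : K} {m : ℕ}
    (h : IsPrimitiveRoot ξ (2 * m)) (hm : 0 < m) : ξ ^ m = -1 := by
  have h1 : ξ ^ m ≠ 1 := h.pow_ne_one_of_pos_of_lt hm.ne' (by omega)
  have h2 : (ξ ^ m) ^ 2 = 1 := by rw [← pow_mul, mul_comm, h.pow_eq_one]
  exact (sq_eq_one_iff.mp h2).resolve_left h1

/-- A polynomial function on `Fin n` supported on `{0, 1, k, l}` evaluates as a four-term sum. -/
theorem Fin.sum_mul_pow_eq_of_support {K : Type*} [CommSemiring K] {n k l : ℕ} (f : Fin n → K)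
    (hk : 1 < k) (hkl : k < l) (hl : l < n)
    (hf : ∀ i : Fin n, (i : ℕ) ≠ 0 → (i : ℕ) ≠ 1 → (i : ℕ) ≠ k → (i : ℕ) ≠ l → f i = 0) (x : K) :
    ∑ i, f i * x ^ (i : ℕ) = f ⟨0, by omega⟩ + f ⟨1, by omega⟩ * x +
      f ⟨k, by omega⟩ * x ^ k + f ⟨l, hl⟩ * x ^ l := by
  rw [← Finset.sum_subset (Finset.subset_univ
    {⟨0, by omega⟩, ⟨1, by omega⟩, ⟨k, by omega⟩, (⟨l, hl⟩ : Fin n)})]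
  · rw [Finset.sum_insert, Finset.sum_insert, Finset.sum_insert, Finset.sum_singleton]
    · simp [add_assoc]
    all_goals simp [Fin.ext_iff]; try omega
  · intro i _ hi
    simp only [Finset.mem_insert, Finset.mem_singleton, Fin.ext_iff, not_or] at hi
    rw [hf i hi.1 hi.2.1 hi.2.2.1 hi.2.2.2, zero_mul]

/-- Splitting a four-term polynomial vanishing at `x` and `-x` into even and odd parts. -/
theorem even_odd_parts_eq_zero {K : Type*} [Field K] (h2 : (2 : K) ≠ 0) {a b c d x : K} {k l : ℕ}
    (hk : Even k) (hl : Odd l)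
    (hp : a + b * x + c * x ^ k + d * x ^ l = 0)
    (hn : a + b * -x + c * (-x) ^ k + d * (-x) ^ l = 0) :
    a + c * x ^ k = 0 ∧ b * x + d * x ^ l = 0 := by
  rw [hk.neg_pow, hl.neg_pow] at hn
  constructor <;> apply mul_left_cancel₀ h2
  · linear_combination hp + hn
  · linear_combination hp - hn

/-- If `a + b X + c X ^ k + d X ^ l` with `k` even, `l` odd and `a, b ≠ 0` vanishes at `±1` and
`±x`, then `x ^ k = 1` and `x ^ l = x`. -/
theorem pow_eq_of_even_odd {K : Type*} [Field K] (h2 : (2 : K) ≠ 0) {a b c d x : K} {k l : ℕ}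
    (hk : Even k) (hl : Odd l) (ha : a ≠ 0) (hb : b ≠ 0)
    (h : ∀ y : K, y = 1 ∨ y = -1 ∨ y = x ∨ y = -x → a + b * y + c * y ^ k + d * y ^ l = 0) :
    x ^ k = 1 ∧ x ^ l = x := by
  obtain ⟨e1, o1⟩ := even_odd_parts_eq_zero h2 hk hl (h 1 (by simp)) (h (-1) (by simp))
  obtain ⟨e2, o2⟩ := even_odd_parts_eq_zero h2 hk hl (h x (by simp)) (h (-x) (by simp))
  rw [one_pow, mul_one] at e1 o1
  constructor
  · apply mul_left_cancel₀ ha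
    linear_combination x ^ k * e1 - e2
  · apply mul_left_cancel₀ hb
    linear_combination x ^ l * o1 - o2

/-- If `a + b X + c X ^ k + d X ^ l` with `k` even, `l` odd and `a, b ≠ 0` vanishes at `±1` and
`±ξ ^ 2`, where `ξ` is a primitive `2m`-th root of unity, then `l = k + 1`. -/
theorem eq_half_of_even_odd {K : Type*} [Field K] (h2 : (2 : K) ≠ 0) {ξ : K} {m : ℕ}
    (hξ : IsPrimitiveRoot ξ (2 * m)) {a b c d : K} {k l : ℕ}
    (hk : Even k) (hl : Odd l) (ha : a ≠ 0) (hb : b ≠ 0)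
    (hk0 : 0 < k) (hl1 : 1 < l) (hkm : k < 2 * m) (hlm : l < 2 * m)
    (h : ∀ y : K, y = 1 ∨ y = -1 ∨ y = ξ ^ 2 ∨ y = -ξ ^ 2 →
      a + b * y + c * y ^ k + d * y ^ l = 0) :
    l = k + 1 := by
  have hm : 0 < m := by omega
  obtain ⟨e, o⟩ := pow_eq_of_even_odd h2 hk hl ha hb h
  have hξ0 : ξ ≠ 0 := hξ.ne_zero (by omega)
  have key : ∀ j, 0 < j → j < 2 * m → (ξ ^ 2) ^ j = 1 → j = m := by
    intro j hj hjm hj1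
    rw [← pow_mul, hξ.pow_eq_one_iff_dvd] at hj1
    obtain ⟨t, ht⟩ := Nat.dvd_of_mul_dvd_mul_left two_pos hj1
    have ht2 : t < 2 := by
      by_contra! hc
      nlinarith
    interval_cases t <;> omega
  have hk' := key k hk0 hkm e
  have hl' := key (l - 1) (by omega) (by omega) (by
    apply mul_right_cancel₀ (pow_ne_zero 2 hξ0)
    rw [← pow_succ, Nat.sub_add_cancel hl1.le, o, one_mul])
  omega


/-- For a prime power `q ≡ 3 (mod 4)` and `n = 4q-4`, the cyclic code
`C = {c ∈ F_q^n : c(1) = c(-1) = c(ξ) = c(ξ^q) = c(ξ^2) = c(ξ^{2q}) = 0}` contains, for all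
`3 ≤ ℓ₁ < ℓ₂ ≤ n-2` with `ℓ₂ - ℓ₁ ≥ 2`, no codeword whose support is exactly `{0, 1, ℓ₁, ℓ₂}`. -/
theorem stmt_7 (q : ℕ) (hq : IsPrimePow q) (hq4 : q % 4 = 3)
    (F F2 : Type) [Field F] [Fintype F]
    [Field F2] [Fintype F2] [Algebra F F2]
    (hF : Fintype.card F = q) (hF2 : Fintype.card F2 = q ^ 2)
    (ξ : F2) (hξ : IsPrimitiveRoot ξ (4 * q - 4))
    (C : Set (Fin (4 * q - 4) → F))
    (hC : C = {c | ∀ α ∈ ({1, -1, ξ, ξ ^ q, ξ ^ 2, ξ ^ (2 * q)} : Set F2),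
      ∑ i : Fin (4 * q - 4), algebraMap F F2 (c i) * α ^ (i : ℕ) = 0}) :
    ∀ ℓ₁ ℓ₂ : ℕ, 3 ≤ ℓ₁ → ℓ₁ < ℓ₂ → ℓ₂ ≤ 4 * q - 4 - 2 → 2 ≤ ℓ₂ - ℓ₁ →
      ¬ ∃ c ∈ C, ∀ i : Fin (4 * q - 4),
        c i ≠ 0 ↔ ((i : ℕ) = 0 ∨ (i : ℕ) = 1 ∨ (i : ℕ) = ℓ₁ ∨ (i : ℕ) = ℓ₂) := by
  rintro ℓ₁ ℓ₂ h3 hlt hle hgap ⟨c, hc, hsupp⟩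
  subst hC
  obtain ⟨m, hm, hm0, hmq⟩ : ∃ m, 4 * q - 4 = 2 * m ∧ 0 < m ∧ 2 * q = m + 2 :=
    ⟨2 * q - 2, by omega, by omega, by omega⟩
  rw [hm] at hξ
  have hpow : ξ ^ m = -1 := hξ.pow_half_eq_neg_one hm0
  have h2 : (2 : F2) ≠ 0 := by
    intro h
    refine hξ.pow_ne_one_of_pos_of_lt hm0.ne' (by omega) ?_
    rw [hpow]
    linear_combination -h
  have hq2 : ξ ^ (2 * q) = -ξ ^ 2 := by rw [hmq, pow_add, hpow, neg_one_mul]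
  set f : Fin (4 * q - 4) → F2 := fun i => algebraMap F F2 (c i) with hf
  have hne : ∀ i : Fin (4 * q - 4),
      ((i : ℕ) = 0 ∨ (i : ℕ) = 1 ∨ (i : ℕ) = ℓ₁ ∨ (i : ℕ) = ℓ₂) → f i ≠ 0 := fun i hi => by
    simpa [hf] using (hsupp i).mpr hi
  have ha := hne ⟨0, by omega⟩ (by simp)
  have hb := hne ⟨1, by omega⟩ (by simp)
  have heval : ∀ y : F2, y = 1 ∨ y = -1 ∨ y = ξ ^ 2 ∨ y = -ξ ^ 2 →
      f ⟨0, by omega⟩ + f ⟨1, by omega⟩ * y + f ⟨ℓ₁, by omega⟩ * y ^ ℓ₁ +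
        f ⟨ℓ₂, by omega⟩ * y ^ ℓ₂ = 0 := by
    intro y hy
    rw [← Fin.sum_mul_pow_eq_of_support f (by omega) hlt (by omega)]
    · apply hc
      rw [hq2]
      simp only [Set.mem_insert_iff, Set.mem_singleton_iff]
      tauto
    · intro i h0 h1 hi1 hi2
      have : c i = 0 := by
        by_contra hci
        have := (hsupp i).mp hci
        tauto
      simp [hf, this]
  have hp := heval 1 (by simp)
  have hn := heval (-1) (by simp)
  rcases Nat.even_or_odd ℓ₁ with h₁ | h₁ <;> rcases Nat.even_or_odd ℓ₂ with h₂ | h₂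
  · rw [h₁.neg_pow, h₂.neg_pow] at hn
    refine hb (mul_left_cancel₀ h2 ?_)
    linear_combination hp - hn
  · have := eq_half_of_even_odd h2 hξ h₁ h₂ ha hb (by omega) (by omega) (by omega) (by omega) heval
    omega
  · have := eq_half_of_even_odd (c := f ⟨ℓ₂, by omega⟩) (d := f ⟨ℓ₁, by omega⟩) h2 hξ h₂ h₁ ha hb
      (by omega) (by omega) (by omega) (by omega)
      fun y hy => by linear_combination heval y hy
    omega
  · rw [h₁.neg_pow, h₂.neg_pow] at hn
    refine ha (mul_left_cancel₀ h2 ?_)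
    linear_combination hp + hn
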